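/- arXiv:1107.3908 — 2 statements merged into one kernel-verified Lean document; each statement's English description precedes it below -/
import Mathlib

section
/- Let p be an odd prime and let (ε_i)_{i≥1} be the unique sequence of rational numbers satisfying, for every integer l ≥ 1, 1/(2l+1)! = Σ_{i=1}^{l} Σ_{j_1+⋯+j_i=l, j_t≥1} 2^i ε_i / ((2j_1)! ⋯ (2j_i)!). Then ε_{(p−1)/2} − 1/p! lies in Z_(p). -/
open Finset in
/-- The defining system of equations for the sequence `(ε_i)_{i ≥ 1}`:
for every `l ≥ 1`,
`1/(2l+1)! = ∑_{i=1}^{l} ∑_{j₁+⋯+jᵢ=l, jₜ≥1} 2^i ε_i / ((2j₁)! ⋯ (2jᵢ)!)`,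
where the inner sum is over tuples of positive integers summing to `l`. -/
def IsEpsilonSeq (ε : ℕ → ℚ) : Prop :=
  ∀ l : ℕ, 1 ≤ l →
    (1 : ℚ) / (Nat.factorial (2 * l + 1) : ℚ) =
      ∑ i ∈ Finset.Icc 1 l,
        ∑ j ∈ (Finset.Nat.antidiagonalTuple i l).filter (fun j => ∀ t, 1 ≤ j t),
          (2 : ℚ) ^ i * ε i / ∏ t, (Nat.factorial (2 * j t) : ℚ)


/-- `x ∈ ℤ_(p)`: the denominator of `x` in lowest terms is not divisible by `p`. -/
def InZLoc (p : ℕ) (x : ℚ) : Prop := ¬ (p : ℕ) ∣ x.den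

namespace InZLoc

theorem add {p : ℕ} (hp : p.Prime) {x y : ℚ} (hx : InZLoc p x) (hy : InZLoc p y) :
    InZLoc p (x + y) := fun h =>
  ((hp.dvd_mul).1 (h.trans (Rat.add_den_dvd x y))).elim hx hy

theorem mul {p : ℕ} (hp : p.Prime) {x y : ℚ} (hx : InZLoc p x) (hy : InZLoc p y) :
    InZLoc p (x * y) := fun h =>
  ((hp.dvd_mul).1 (h.trans (Rat.mul_den_dvd x y))).elim hx hy

theorem neg {p : ℕ} {x : ℚ} (hx : InZLoc p x) : InZLoc p (-x) := by
  simpa [InZLoc] using hx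

theorem natCast {p : ℕ} (hp : p.Prime) (n : ℕ) : InZLoc p (n : ℚ) := by
  simpa [InZLoc] using hp.ne_one

theorem sum {p : ℕ} (hp : p.Prime) {ι : Type*} {s : Finset ι} {f : ι → ℚ}
    (h : ∀ i ∈ s, InZLoc p (f i)) : InZLoc p (∑ i ∈ s, f i) :=
  Finset.sum_induction f (InZLoc p) (fun _ _ => add hp) (by simpa using natCast hp 0) h

theorem inv_natCast {p n : ℕ} (h : ¬ p ∣ n) : InZLoc p ((n : ℚ)⁻¹) := by
  have hn : 0 < n := Nat.pos_of_ne_zero fun h0 => h (h0 ▸ dvd_zero p)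
  simpa [InZLoc, Rat.inv_natCast_den_of_pos hn] using h

end InZLoc

theorem antidiagonalTuple_self_filter_pos (l : ℕ) :
    (Finset.Nat.antidiagonalTuple l l).filter (fun j => ∀ t, 1 ≤ j t) = {fun _ => 1} := by
  ext j
  simp only [Finset.mem_filter, Finset.Nat.mem_antidiagonalTuple, Finset.mem_singleton]
  refine ⟨fun ⟨hs, hj⟩ => ?_, fun h => by simp [h]⟩
  have hsum : ∑ _t : Fin l, 1 = ∑ t, j t := by simp [hs]
  funext t
  exact ((Finset.sum_eq_sum_iff_of_le fun t _ => hj t).1 hsum t (Finset.mem_univ t)).symm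

theorem IsEpsilonSeq.eq_add {ε : ℕ → ℚ} (hε : IsEpsilonSeq ε) {l : ℕ} (hl : 1 ≤ l) :
    (1 : ℚ) / (Nat.factorial (2 * l + 1) : ℚ) =
      (∑ i ∈ Finset.Ico 1 l,
        ∑ j ∈ (Finset.Nat.antidiagonalTuple i l).filter (fun j => ∀ t, 1 ≤ j t),
          (2 : ℚ) ^ i * ε i / ∏ t, (Nat.factorial (2 * j t) : ℚ)) + ε l := by
  rw [hε l hl, ← Finset.Ico_insert_right hl, Finset.sum_insert (by simp), add_comm,
    antidiagonalTuple_self_filter_pos]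
  simp

theorem InZLoc.epsilon_lower_sum {p : ℕ} (hp : p.Prime) {ε : ℕ → ℚ} {l : ℕ} (hl : 2 * l < p)
    (h : ∀ i, 1 ≤ i → i < l → InZLoc p (ε i)) :
    InZLoc p (∑ i ∈ Finset.Ico 1 l,
        ∑ j ∈ (Finset.Nat.antidiagonalTuple i l).filter (fun j => ∀ t, 1 ≤ j t),
          (2 : ℚ) ^ i * ε i / ∏ t, (Nat.factorial (2 * j t) : ℚ)) := by
  refine sum hp fun i hi => sum hp fun j hj => ?_
  rw [Finset.mem_Ico] at hi
  rw [Finset.mem_filter, Finset.Nat.mem_antidiagonalTuple] at hj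
  rw [div_eq_mul_inv]
  refine mul hp (mul hp (by simpa using natCast hp (2 ^ i)) (h i hi.1 hi.2)) ?_
  rw [← Nat.cast_prod]
  refine inv_natCast fun hd => ?_
  obtain ⟨t, -, ht⟩ := (hp.prime.dvd_finsetProd_iff _).1 hd
  have h1 := hp.dvd_factorial.1 ht
  have h2 : j t ≤ l := hj.1 ▸ Finset.single_le_sum (fun _ _ => Nat.zero_le _) (Finset.mem_univ t)
  omega

theorem IsEpsilonSeq.inZLoc {p : ℕ} (hp : p.Prime) {ε : ℕ → ℚ} (hε : IsEpsilonSeq ε) (l : ℕ)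
    (hl : 1 ≤ l) (hlp : 2 * l + 1 < p) : InZLoc p (ε l) := by
  induction l using Nat.strong_induction_on with
  | _ l ih =>
    rw [eq_sub_of_add_eq' (hε.eq_add hl).symm, sub_eq_add_neg]
    refine InZLoc.add hp ?_ (InZLoc.neg (InZLoc.epsilon_lower_sum hp (by omega)
      fun i hi hil => ih i hil hi (by omega)))
    rw [one_div]
    exact InZLoc.inv_natCast fun hd => by have := hp.dvd_factorial.1 hd; omega

theorem stmt6 (p : ℕ) (hp : p.Prime) (hodd : Odd p)
    (ε : ℕ → ℚ) (hε : IsEpsilonSeq ε) :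
    InZLoc p (ε ((p - 1) / 2) - 1 / (Nat.factorial p : ℚ)) := by
  obtain ⟨m, rfl⟩ := hodd
  have hm : 1 ≤ m := by have := hp.two_le; omega
  rw [show (2 * m + 1 - 1) / 2 = m by omega, hε.eq_add hm, sub_add_cancel_right]
  exact InZLoc.neg (InZLoc.epsilon_lower_sum hp (by omega)
    fun i hi him => hε.inZLoc hp i hi (by omega))
end

section
/- Let p be an odd prime and let (ε_i)_{i≥1} be the unique sequence of rational numbers satisfying, for every integer l ≥ 1, 1/(2l+1)! = Σ_{i=1}^{l} Σ_{j_1+⋯+j_i=l, j_t≥1} 2^i ε_i / ((2j_1)! ⋯ (2j_i)!). Then p·ε_{p−1} + 1/((p+1)!·(p−2)!) lies in Z_(p); in particular, p·ε_{p−1} does not lie in Z_(p). -/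
namespace PowerSeries

theorem coeff_pow_eq_sum_antidiagonalTuple {R : Type*} [CommSemiring R] (f : PowerSeries R)
    (i l : ℕ) :
    coeff l (f ^ i) = ∑ j ∈ Finset.Nat.antidiagonalTuple i l, ∏ t, coeff (j t) f := by
  have h := coeff_prod (fun _ : Fin i => f) l Finset.univ
  rw [Finset.prod_const, Finset.card_univ, Fintype.card_fin] at h
  rw [h]
  refine Finset.sum_nbij' (fun g => ⇑g) (fun j => Finsupp.equivFunOnFinite.symm j) ?_ ?_ ?_ ?_ ?_
  · intro g hg
    simpa [Finset.Nat.mem_antidiagonalTuple, Finset.mem_finsuppAntidiag] using hg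
  · intro j hj
    simpa [Finset.Nat.mem_antidiagonalTuple, Finset.mem_finsuppAntidiag] using hj
  · intro g _
    ext; simp
  · intro j _
    ext; simp
  · intro g _
    rfl

theorem subst_injective_of_isUnit_coeff_one {R : Type*} [CommRing R] {g : PowerSeries R}
    (h0 : constantCoeff g = 0) (h1 : IsUnit (coeff 1 g)) :
    Function.Injective fun f : PowerSeries R => f.subst g := by
  intro a b hab
  have hg : HasSubst g := HasSubst.of_constantCoeff_zero' h0
  have hi := HasSubst.substInvOfIsUnit g h1
  have key : ∀ f : PowerSeries R, subst (g.substInvOfIsUnit h1) (f.subst g) = f := by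
    intro f
    rw [subst_comp_subst_apply hg hi, subst_substInvOfIsUnit_right g h0 h1,
      ← map_algebraMap_eq_subst_X]
    simp
  rw [← key a, ← key b]
  exact congrArg (subst (g.substInvOfIsUnit h1)) hab

end PowerSeries

section EpsilonSeries

open PowerSeries

/-- The series `sinh x / x` in the variable `t = x²`. -/
noncomputable def sinhcSeries : PowerSeries ℚ :=
  mk fun n => 1 / ((2 * n + 1).factorial : ℚ)

/-- The series `2 (cosh x - 1)` in the variable `t = x²`. -/
noncomputable def coshSeries : PowerSeries ℚ :=
  mk fun n => if n = 0 then 0 else 2 / ((2 * n).factorial : ℚ)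

/-- The coefficients of `x / sinh x` as a power series in `2 (cosh x - 1)`. -/
def invSinhcCoeff (n : ℕ) : ℚ :=
  (-1) ^ n * (n.factorial : ℚ) ^ 2 / ((2 * n + 1).factorial : ℚ)

theorem invSinhcCoeff_succ (n : ℕ) :
    invSinhcCoeff (n + 1) =
        -((n + 1 : ℕ) : ℚ) * ((2 * (2 * n + 3) : ℕ) : ℚ)⁻¹ * invSinhcCoeff n := by
  unfold invSinhcCoeff
  rw [show 2 * (n + 1) + 1 = (2 * n + 1 + 1) + 1 by ring, Nat.factorial_succ (2 * n + 1 + 1),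
    Nat.factorial_succ (2 * n + 1), Nat.factorial_succ n]
  have : ((2 * n + 1).factorial : ℚ) ≠ 0 := by positivity
  push_cast
  field_simp
  ring

theorem constantCoeff_coshSeries : constantCoeff coshSeries = 0 := by
  simp [coshSeries, ← coeff_zero_eq_constantCoeff_apply]

theorem hasSubst_coshSeries : HasSubst coshSeries :=
  HasSubst.of_constantCoeff_zero' constantCoeff_coshSeries

theorem derivative_coshSeries : d⁄dX ℚ coshSeries = sinhcSeries := by
  ext n
  rw [coeff_derivative]
  simp only [coshSeries, sinhcSeries, coeff_mk, Nat.add_eq_zero_iff, one_ne_zero, and_false,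
    if_false]
  rw [show 2 * (n + 1) = (2 * n + 1) + 1 by ring, Nat.factorial_succ]
  have : ((2 * n + 1).factorial : ℚ) ≠ 0 := by positivity
  push_cast
  field_simp
  ring

theorem sinhcSeries_add_derivative :
    sinhcSeries + 2 * (X * d⁄dX ℚ sinhcSeries) = 1 + C (1 / 2) * coshSeries := by
  ext n
  have h2 : (2 : PowerSeries ℚ) = C 2 := (map_ofNat C 2).symm
  rw [h2, map_add, map_add, coeff_C_mul, coeff_C_mul]
  cases n with
  | zero => simp [sinhcSeries, coshSeries]
  | succ n =>
    rw [coeff_succ_X_mul, coeff_derivative, coeff_one]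
    simp only [coshSeries, sinhcSeries, coeff_mk, Nat.add_eq_zero_iff, one_ne_zero, and_false,
      if_false]
    rw [Nat.factorial_succ]
    have : ((2 * (n + 1)).factorial : ℚ) ≠ 0 := by positivity
    push_cast
    field_simp
    ring

theorem X_mul_sinhcSeries_sq :
    X * sinhcSeries ^ 2 = coshSeries + C (1 / 4) * coshSeries ^ 2 := by
  apply derivative.ext
  · have h := sinhcSeries_add_derivative
    have h4 : (C (1 / 2) : PowerSeries ℚ) = C (1 / 4) * 2 := by
      rw [show (2 : PowerSeries ℚ) = C 2 from (map_ofNat C 2).symm, ← map_mul]; norm_num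
    rw [h4] at h
    simp only [Derivation.leibniz, Derivation.leibniz_pow, map_add, derivative_X, derivative_C,
      derivative_coshSeries, smul_eq_mul, nsmul_eq_mul]
    push_cast
    linear_combination sinhcSeries * h
  · simp [constantCoeff_coshSeries]

theorem mk_invSinhcCoeff_ode :
    (1 + C (1 / 2) * X) * mk invSinhcCoeff
      + 2 * ((X + C (1 / 4) * X ^ 2) * d⁄dX ℚ (mk invSinhcCoeff)) = 1 := by
  have h2 : (2 : PowerSeries ℚ) = C 2 := (map_ofNat C 2).symm
  ext n
  have e : (1 + C (1 / 2) * X) * mk invSinhcCoeff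
      + 2 * ((X + C (1 / 4) * X ^ 2) * d⁄dX ℚ (mk invSinhcCoeff))
      = mk invSinhcCoeff + C (1 / 2) * (X * mk invSinhcCoeff)
        + C 2 * (X * d⁄dX ℚ (mk invSinhcCoeff))
        + C (1 / 2) * (X * (X * d⁄dX ℚ (mk invSinhcCoeff))) := by
    have h4 : (C (1 / 2) : PowerSeries ℚ) = C (1 / 4) * C 2 := by
      rw [← map_mul]; norm_num
    rw [h2, h4]
    ring
  rw [e]
  simp only [map_add, coeff_C_mul]
  rcases n with _ | _ | n
  · simp [invSinhcCoeff]
  · simp only [coeff_succ_X_mul, coeff_zero_X_mul, coeff_derivative, coeff_mk, coeff_one]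
    norm_num [invSinhcCoeff, Nat.factorial]
  · simp only [coeff_succ_X_mul, coeff_derivative, coeff_mk, coeff_one]
    rw [invSinhcCoeff_succ (n + 1)]
    push_cast
    simp
    field_simp
    ring

theorem subst_mk_invSinhcCoeff_mul_sinhcSeries :
    (mk invSinhcCoeff).subst coshSeries * sinhcSeries = 1 := by
  have hs := hasSubst_coshSeries
  set W := (mk invSinhcCoeff).subst coshSeries with hW
  have hd : d⁄dX ℚ W = (d⁄dX ℚ (mk invSinhcCoeff)).subst coshSeries * sinhcSeries := by
    rw [hW, derivative_subst hs, derivative_coshSeries]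
  have hC : ∀ r : ℚ, (C r : PowerSeries ℚ).subst coshSeries = C r := fun r => subst_C r
  have h1 : (1 : PowerSeries ℚ).subst coshSeries = 1 := by
    simpa using hC 1
  have h2 : (2 : PowerSeries ℚ).subst coshSeries = 2 := by
    rw [show (2 : PowerSeries ℚ) = C 2 from (map_ofNat C 2).symm]
    exact hC 2
  have ode := congrArg (fun f => f.subst coshSeries) mk_invSinhcCoeff_ode
  simp only [subst_add hs, subst_mul hs, subst_pow hs, hC, h1, h2, subst_X hs, ← hW] at ode
  rw [← X_mul_sinhcSeries_sq, ← sinhcSeries_add_derivative] at ode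
  have key : W * sinhcSeries + 2 * (X * d⁄dX ℚ (W * sinhcSeries)) = 1 := by
    rw [Derivation.leibniz, hd, smul_eq_mul, smul_eq_mul]
    linear_combination ode
  ext n
  have hn := congrArg (coeff n) key
  rw [show (2 : PowerSeries ℚ) = C 2 from (map_ofNat C 2).symm, map_add, coeff_C_mul] at hn
  cases n with
  | zero => simpa using hn
  | succ n =>
    rw [coeff_succ_X_mul, coeff_derivative] at hn
    simp only [coeff_one, Nat.add_eq_zero_iff, one_ne_zero, and_false, if_false] at hn ⊢
    have : coeff (n + 1) (W * sinhcSeries) * (2 * n + 3) = 0 := by linear_combination hn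
    exact (mul_eq_zero.mp this).resolve_right (by positivity)

theorem IsEpsilonSeq.subst_coshSeries {ε : ℕ → ℚ} (hε : IsEpsilonSeq ε) :
    (mk fun i => if i = 0 then 1 else ε i).subst coshSeries = sinhcSeries := by
  ext l
  rw [coeff_subst' hasSubst_coshSeries]
  have hlt : ∀ d, l < d → coeff l (coshSeries ^ d) = 0 := by
    intro d hd
    refine X_pow_dvd_iff.mp (pow_dvd_pow_of_dvd ?_ d) l hd
    exact X_dvd_iff.mpr constantCoeff_coshSeries
  rcases Nat.eq_zero_or_pos l with rfl | hl
  · rw [finsum_eq_single _ 0]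
    · simp [sinhcSeries]
    · intro d hd
      rw [hlt d (Nat.pos_of_ne_zero hd), smul_zero]
  · rw [finsum_eq_sum_of_support_subset (s := Finset.Icc 1 l)]
    · rw [sinhcSeries, coeff_mk, hε l hl]
      refine Finset.sum_congr rfl fun i hi => ?_
      have hi0 : i ≠ 0 := by have := (Finset.mem_Icc.mp hi).1; omega
      rw [coeff_pow_eq_sum_antidiagonalTuple, coeff_mk, if_neg hi0, smul_eq_mul, Finset.mul_sum,
        Finset.sum_filter]
      refine Finset.sum_congr rfl fun j _ => ?_
      split_ifs with hj
      · have : ∀ t, coeff (j t) coshSeries = 2 / ((2 * j t).factorial : ℚ) := by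
          intro t
          rw [coshSeries, coeff_mk, if_neg (by have := hj t; omega)]
        simp only [this, Finset.prod_div_distrib, Finset.prod_const, Finset.card_univ,
          Fintype.card_fin]
        ring
      · push Not at hj
        obtain ⟨t, ht⟩ := hj
        rw [Finset.prod_eq_zero (Finset.mem_univ t), mul_zero]
        rw [coshSeries, coeff_mk, if_pos (by omega)]
    · intro d hd
      rw [Function.mem_support] at hd
      rw [Finset.coe_Icc, Set.mem_Icc]
      by_contra hcon
      apply hd
      rcases Nat.eq_zero_or_pos d with rfl | hd0
      · rw [pow_zero, coeff_one, if_neg (by omega), smul_zero]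
      · rw [hlt d (by omega), smul_zero]

theorem IsEpsilonSeq.mk_mul_mk_invSinhcCoeff {ε : ℕ → ℚ} (hε : IsEpsilonSeq ε) :
    (mk fun i => if i = 0 then 1 else ε i) * mk invSinhcCoeff = 1 := by
  have h1 : IsUnit (coeff 1 coshSeries) := by
    simp [coshSeries]
  apply subst_injective_of_isUnit_coeff_one constantCoeff_coshSeries h1
  have hC : (1 : PowerSeries ℚ).subst coshSeries = 1 := by
    simpa using (subst_C (a := coshSeries) (1 : ℚ))
  simp only [subst_mul hasSubst_coshSeries, hC, hε.subst_coshSeries]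
  rw [mul_comm, subst_mk_invSinhcCoeff_mul_sinhcSeries]

end EpsilonSeries

section LocalizationAtPrime

/-- The subring `ℤ_(p)` of `ℚ`. -/
def zLoc (p : ℕ) (hp : p.Prime) : Subring ℚ where
  carrier := {x | InZLoc p x}
  one_mem' := by simpa [InZLoc] using hp.one_lt.ne'
  zero_mem' := by simpa [InZLoc] using hp.one_lt.ne'
  add_mem' := by
    intro a b ha hb h
    exact (hp.dvd_mul.mp (h.trans (Rat.add_den_dvd a b))).elim ha hb
  mul_mem' := by
    intro a b ha hb h
    exact (hp.dvd_mul.mp (h.trans (Rat.mul_den_dvd a b))).elim ha hb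
  neg_mem' := by
    intro a ha
    simpa [InZLoc] using ha

variable {p : ℕ} (hp : p.Prime)

theorem mem_zLoc {x : ℚ} : x ∈ zLoc p hp ↔ InZLoc p x := Iff.rfl

theorem inv_natCast_mem_zLoc {n : ℕ} (hn : ¬ p ∣ n) : (n : ℚ)⁻¹ ∈ zLoc p hp := by
  have h0 : n ≠ 0 := by rintro rfl; exact hn (dvd_zero p)
  rw [mem_zLoc, InZLoc, Rat.inv_natCast_den, if_neg h0]
  exact hn

theorem inv_prime_notMem_zLoc : (p : ℚ)⁻¹ ∉ zLoc p hp := by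
  rw [mem_zLoc, InZLoc, Rat.inv_natCast_den, if_neg hp.ne_zero]
  simp

theorem invSinhcCoeff_mem_zLoc (hodd : Odd p) {k : ℕ} (hk : 2 * k + 1 < p) :
    invSinhcCoeff k ∈ zLoc p hp := by
  induction k with
  | zero => simp [invSinhcCoeff]
  | succ k ih =>
    rw [invSinhcCoeff_succ]
    refine mul_mem (mul_mem (neg_mem (natCast_mem _ _)) (inv_natCast_mem_zLoc hp ?_))
      (ih (by omega))
    have h2 : ¬ p ∣ 2 := fun h => by
      have := (Nat.prime_dvd_prime_iff_eq hp Nat.prime_two).mp h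
      subst this; exact absurd hodd (by decide)
    intro h
    refine (hp.dvd_mul.mp h).elim h2 fun h => ?_
    have := Nat.le_of_dvd (by omega) h
    omega

theorem mul_invSinhcCoeff_mem_zLoc (hodd : Odd p) {k : ℕ} (hk : 2 * k + 1 < 2 * p) :
    (p : ℚ) * invSinhcCoeff k ∈ zLoc p hp := by
  have h2 : ¬ p ∣ 2 := fun h => by
    have := (Nat.prime_dvd_prime_iff_eq hp Nat.prime_two).mp h
    subst this; exact absurd hodd (by decide)
  induction k with
  | zero => simp [invSinhcCoeff]
  | succ k ih =>
    by_cases hkp : 2 * k + 3 = p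
    · have hinv := inv_natCast_mem_zLoc hp h2
      have hmem := invSinhcCoeff_mem_zLoc hp hodd (k := k) (by omega)
      have hp0 : (p : ℚ) ≠ 0 := by exact_mod_cast hp.ne_zero
      have e : (p : ℚ) * invSinhcCoeff (k + 1)
          = -((k + 1 : ℕ) : ℚ) * ((2 : ℕ) : ℚ)⁻¹ * invSinhcCoeff k := by
        rw [invSinhcCoeff_succ, hkp]
        push_cast
        field_simp
      rw [e]
      exact mul_mem (mul_mem (neg_mem (natCast_mem _ _)) hinv) hmem
    · rw [invSinhcCoeff_succ, mul_left_comm]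
      refine mul_mem (mul_mem (neg_mem (natCast_mem _ _)) (inv_natCast_mem_zLoc hp ?_))
        (ih (by omega))
      intro h
      refine (hp.dvd_mul.mp h).elim h2 fun h => ?_
      obtain ⟨c, hc⟩ := h
      have hc1 : c = 1 := by
        have h0 : c ≠ 0 := by rintro rfl; omega
        have : c < 2 := by
          by_contra hcon
          have := Nat.mul_le_mul_left p (not_lt.mp hcon)
          omega
        omega
      subst hc1
      omega

theorem exists_mem_zLoc_of_natCast_zmod_eq [Fact p.Prime] {a b : ℕ} (h : (a : ZMod p) = b) :
    ∃ z ∈ zLoc p hp, (a : ℚ) - b = p * z := by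
  have h' : ((a - b : ℤ) : ZMod p) = 0 := by push_cast; rw [h, sub_self]
  obtain ⟨c, hc⟩ := (ZMod.intCast_zmod_eq_zero_iff_dvd _ p).mp h'
  exact ⟨c, intCast_mem _ c, by exact_mod_cast hc⟩

theorem choose_pred_prime_zmod [Fact p.Prime] {k : ℕ} (hk : k < p) :
    (((p - 1).choose k : ℕ) : ZMod p) = (-1) ^ k := by
  have hpp : p.Prime := Fact.out
  induction k with
  | zero => simp
  | succ k ih =>
    have h := Nat.choose_succ_succ (p - 1) k
    rw [Nat.succ_eq_add_one, Nat.sub_add_cancel hpp.one_le] at h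
    have h0 : ((p.choose (k + 1) : ℕ) : ZMod p) = 0 :=
      (ZMod.natCast_eq_zero_iff _ _).mpr (hpp.dvd_choose_self (by omega) hk)
    rw [h, Nat.cast_add, ih (by omega)] at h0
    rw [pow_succ]
    linear_combination h0

/-- At `k = (p - 1) / 2`, the square of `p` times the coefficient is congruent to `1`. -/
theorem exists_mem_zLoc_sq_mul_invSinhcCoeff {m : ℕ} (hm : p = 2 * m + 1) :
    ∃ z ∈ zLoc p hp, ((p : ℚ) * invSinhcCoeff m) ^ 2 = 1 + p * z := by
  have : Fact p.Prime := ⟨hp⟩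
  have hch := choose_pred_prime_zmod (p := p) (k := m) (by omega)
  have hsq : (((p - 1).choose m ^ 2 : ℕ) : ZMod p) = (1 : ℕ) := by
    rw [Nat.cast_pow, hch, ← pow_mul, mul_comm, pow_mul]; simp
  have hnd : ¬ p ∣ (p - 1).choose m ^ 2 := by
    rw [← ZMod.natCast_eq_zero_iff, hsq]; simp
  obtain ⟨z, hz, hze⟩ := exists_mem_zLoc_of_natCast_zmod_eq hp hsq
  refine ⟨-z * (((p - 1).choose m ^ 2 : ℕ) : ℚ)⁻¹,
    mul_mem (neg_mem hz) (inv_natCast_mem_zLoc hp hnd), ?_⟩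
  have hfac : (p : ℚ) * invSinhcCoeff m * ((p - 1).choose m : ℚ) = (-1) ^ m := by
    have h := Nat.choose_mul_factorial_mul_factorial (n := 2 * m) (k := m) (by omega)
    rw [show 2 * m - m = m by omega] at h
    have h' : ((2 * m).choose m : ℚ) * m.factorial * m.factorial = (2 * m).factorial := by
      exact_mod_cast h
    have hp0 : (2 * m + 1 : ℚ) ≠ 0 := by positivity
    have hf0 : ((2 * m).factorial : ℚ) ≠ 0 := by positivity
    rw [invSinhcCoeff, hm, Nat.add_sub_cancel, Nat.factorial_succ]
    push_cast
    field_simp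
    linear_combination h'
  have hc0 : ((p - 1).choose m : ℚ) ≠ 0 := by
    intro h0
    rw [h0, mul_zero] at hfac
    exact pow_ne_zero m (by norm_num) hfac.symm
  have hone : ((-1 : ℚ) ^ m) ^ 2 = 1 := by rw [← pow_mul, mul_comm, pow_mul]; simp
  push_cast at hze ⊢
  field_simp
  linear_combination (p * invSinhcCoeff m * ((p - 1).choose m : ℚ) + (-1) ^ m) * hfac + hone - hze

theorem one_div_factorial_add_one_div_mem_zLoc :
    1 / (((p + 1).factorial : ℚ) * ((p - 2).factorial : ℚ)) + 1 / p ∈ zLoc p hp := by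
  have : Fact p.Prime := ⟨hp⟩
  obtain ⟨q, hq⟩ : ∃ q, p = q + 2 := ⟨p - 2, by have := hp.two_le; omega⟩
  have hw := ZMod.wilsons_lemma p
  have hq2 : (q : ZMod p) = -2 := by
    have : ((q + 2 : ℕ) : ZMod p) = 0 := by rw [← hq]; simp
    push_cast at this
    linear_combination this
  have hp1 : p - 1 = q + 1 := by omega
  have hp2 : p - 2 = q := by omega
  rw [hp1, Nat.factorial_succ] at hw
  push_cast at hw
  rw [hq2] at hw
  have hqf : ((q.factorial : ℕ) : ZMod p) = 1 := by linear_combination -hw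
  set u : ℕ := (q + 3) * (q + 1) * q.factorial ^ 2 with hu
  have huz : ((u + 1 : ℕ) : ZMod p) = (0 : ℕ) := by
    rw [hu]; push_cast; rw [hqf, hq2]; ring
  have hnd : ¬ p ∣ u := by
    rw [← ZMod.natCast_eq_zero_iff]
    intro h0
    push_cast at huz
    rw [h0] at huz
    simp at huz
  obtain ⟨z, hz, hze⟩ := exists_mem_zLoc_of_natCast_zmod_eq hp huz
  have e : 1 / (((p + 1).factorial : ℚ) * ((p - 2).factorial : ℚ)) + 1 / p = z * (u : ℚ)⁻¹ := by
    have h1 : (((p + 1).factorial : ℚ) * ((p - 2).factorial : ℚ)) = p * u := by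
      rw [hp2, hu, hq, Nat.factorial_succ, Nat.factorial_succ, Nat.factorial_succ]
      push_cast
      ring
    have hp0 : (p : ℚ) ≠ 0 := by exact_mod_cast hp.ne_zero
    have hu0 : (u : ℚ) ≠ 0 := by
      intro h; apply hnd; rw [Nat.cast_eq_zero.mp h]; exact dvd_zero p
    rw [h1]
    push_cast at hze
    field_simp
    linear_combination hze
  rw [e]
  exact mul_mem hz (inv_natCast_mem_zLoc hp hnd)

variable {e : ℕ → ℚ}

theorem reciprocal_coeff_mem_zLoc {m : ℕ} {h : ℕ → ℚ} (he0 : e 0 = 1)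
    (hrec : ∀ n, 0 < n → e n = -∑ k ∈ Finset.range n, h (k + 1) * e (n - (k + 1)))
    (hh : ∀ k < m, h k ∈ zLoc p hp) : ∀ n < m, e n ∈ zLoc p hp := by
  intro n
  induction n using Nat.strong_induction_on with
  | _ n ih =>
    intro hn
    rcases Nat.eq_zero_or_pos n with rfl | hn0
    · rw [he0]; exact one_mem _
    · rw [hrec n hn0]
      refine neg_mem (sum_mem fun k hk => ?_)
      have := Finset.mem_range.mp hk
      exact mul_mem (hh _ (by omega)) (ih _ (by omega) (by omega))

theorem mul_reciprocal_coeff_mem_zLoc {m : ℕ} {h : ℕ → ℚ} (he0 : e 0 = 1)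
    (hrec : ∀ n, 0 < n → e n = -∑ k ∈ Finset.range n, h (k + 1) * e (n - (k + 1)))
    (hh : ∀ k < m, h k ∈ zLoc p hp) (hph : ∀ k < 2 * m, (p : ℚ) * h k ∈ zLoc p hp) :
    ∀ n < 2 * m, (p : ℚ) * e n ∈ zLoc p hp := by
  have hsmall := reciprocal_coeff_mem_zLoc hp he0 hrec hh
  intro n
  induction n using Nat.strong_induction_on with
  | _ n ih =>
    intro hn
    rcases lt_or_ge n m with hnm | hnm
    · exact mul_mem (natCast_mem _ _) (hsmall n hnm)
    · rw [hrec n (by omega), mul_neg, Finset.mul_sum]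
      refine neg_mem (sum_mem fun k hk => ?_)
      have := Finset.mem_range.mp hk
      rcases lt_or_ge (k + 1) m with hkm | hkm
      · rw [mul_left_comm]
        exact mul_mem (hh _ hkm) (ih _ (by omega) (by omega))
      · rw [← mul_assoc]
        exact mul_mem (hph _ (by omega)) (hsmall _ (by omega))

theorem reciprocal_coeff_add_mem_zLoc {m : ℕ} {h : ℕ → ℚ} (hm : 0 < m)
    (he0 : e 0 = 1)
    (hrec : ∀ n, 0 < n → e n = -∑ k ∈ Finset.range n, h (k + 1) * e (n - (k + 1)))
    (hh : ∀ k < m, h k ∈ zLoc p hp) : e m + h m ∈ zLoc p hp := by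
  have hsmall := reciprocal_coeff_mem_zLoc hp he0 hrec hh
  obtain ⟨r, rfl⟩ : ∃ r, m = r + 1 := ⟨m - 1, by omega⟩
  rw [hrec _ hm, Finset.sum_range_succ, Nat.sub_self, he0, mul_one, neg_add, neg_add_cancel_right]
  refine neg_mem (sum_mem fun k hk => ?_)
  have := Finset.mem_range.mp hk
  exact mul_mem (hh _ (by omega)) (hsmall _ (by omega))

theorem mul_reciprocal_coeff_two_mul_sub_mem_zLoc {m : ℕ} {h : ℕ → ℚ} (hm : 0 < m)
    (he0 : e 0 = 1)
    (hrec : ∀ n, 0 < n → e n = -∑ k ∈ Finset.range n, h (k + 1) * e (n - (k + 1)))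
    (hh : ∀ k < m, h k ∈ zLoc p hp) (hph : ∀ k ≤ 2 * m, (p : ℚ) * h k ∈ zLoc p hp) :
    (p : ℚ) * e (2 * m) - p * h m ^ 2 ∈ zLoc p hp := by
  have hsmall := reciprocal_coeff_mem_zLoc hp he0 hrec hh
  have hmid := reciprocal_coeff_add_mem_zLoc hp hm he0 hrec hh
  have hbig := mul_reciprocal_coeff_mem_zLoc hp he0 hrec hh fun k hk => hph k (by omega)
  have hmem : m - 1 ∈ Finset.range (2 * m) := Finset.mem_range.mpr (by omega)
  rw [hrec _ (by omega), ← Finset.add_sum_erase _ _ hmem, show m - 1 + 1 = m by omega,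
    show 2 * m - m = m by omega]
  have e1 : (p : ℚ) * -(h m * e m + ∑ k ∈ (Finset.range (2 * m)).erase (m - 1),
        h (k + 1) * e (2 * m - (k + 1))) - p * h m ^ 2
      = -(p * h m * (e m + h m) + ∑ k ∈ (Finset.range (2 * m)).erase (m - 1),
        p * (h (k + 1) * e (2 * m - (k + 1)))) := by
    rw [← Finset.mul_sum]; ring
  rw [e1]
  refine neg_mem (add_mem (mul_mem (hph m (by omega)) hmid) (sum_mem fun k hk => ?_))
  obtain ⟨hk1, hk2⟩ := Finset.mem_erase.mp hk
  rw [Finset.mem_range] at hk2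
  rcases lt_or_ge (k + 1) m with hkm | hkm
  · rw [mul_left_comm]
    exact mul_mem (hh _ hkm) (hbig _ (by omega))
  · rw [← mul_assoc]
    exact mul_mem (hph _ (by omega)) (hsmall _ (by omega))

end LocalizationAtPrime

theorem stmt8 (p : ℕ) (hp : p.Prime) (hodd : Odd p)
    (ε : ℕ → ℚ) (hε : IsEpsilonSeq ε) :
    InZLoc p ((p : ℚ) * ε (p - 1)
        + 1 / ((Nat.factorial (p + 1) : ℚ) * (Nat.factorial (p - 2) : ℚ)))
      ∧ ¬ InZLoc p ((p : ℚ) * ε (p - 1)) := by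
  obtain ⟨m, hm⟩ := id hodd
  have hm0 : 0 < m := by have := hp.two_le; omega
  have hp0 : (p : ℚ) ≠ 0 := by exact_mod_cast hp.ne_zero
  have hmul := hε.mk_mul_mk_invSinhcCoeff
  set e : ℕ → ℚ := fun i => if i = 0 then 1 else ε i with he
  have hrec : ∀ n, 0 < n →
      e n = -∑ k ∈ Finset.range n, invSinhcCoeff (k + 1) * e (n - (k + 1)) := by
    intro n hn
    have h := congrArg (PowerSeries.coeff n) hmul
    rw [mul_comm, PowerSeries.coeff_mul, PowerSeries.coeff_one, if_neg hn.ne',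
      Finset.Nat.sum_antidiagonal_eq_sum_range_succ_mk, Finset.sum_range_succ'] at h
    simp only [PowerSeries.coeff_mk, Nat.sub_zero] at h
    rw [show invSinhcCoeff 0 = 1 by simp [invSinhcCoeff], one_mul] at h
    linear_combination h
  have hmain := mul_reciprocal_coeff_two_mul_sub_mem_zLoc hp hm0 (by simp [he]) hrec
    (fun k hk => invSinhcCoeff_mem_zLoc hp hodd (by omega))
    (fun k hk => mul_invSinhcCoeff_mem_zLoc hp hodd (by omega))
  obtain ⟨z, hz, hze⟩ := exists_mem_zLoc_sq_mul_invSinhcCoeff hp hm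
  have hval : e (2 * m) = ε (p - 1) := by
    rw [he, show p - 1 = 2 * m by omega]
    exact if_neg (by omega)
  rw [hval] at hmain
  have hdiff : (p : ℚ) * ε (p - 1) - 1 / p ∈ zLoc p hp := by
    have hsq : (p : ℚ) * invSinhcCoeff m ^ 2 = 1 / p + z := by
      field_simp
      linear_combination hze
    rw [hsq] at hmain
    convert add_mem hmain hz using 1
    ring
  constructor
  · have h := add_mem hdiff (one_div_factorial_add_one_div_mem_zLoc hp)
    rw [← mem_zLoc hp]
    convert h using 1
    ring
  · intro h
    apply inv_prime_notMem_zLoc hp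
    convert sub_mem ((mem_zLoc hp).mpr h) hdiff using 1
    ring
end
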